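/- arXiv:2012.05026 — 2 statements merged into one kernel-verified Lean document; each statement's English description precedes it below -/
import Mathlib

section
/- (Lemma 2.3, elementary variational inequality) Let N∈ℕ. For any α_i, p_i ≥ 1 and β_i > 0, i = 1,…,N, there is a constant C = C(α_i,β_i,p_i,N) > 0 such that for all f_i ∈ L^∞([τ,δ]) and all τ<δ with 0 < δ−τ ≤ 1: the infimum, over all ℓ∈C¹([τ,δ]) with ℓ'(s) ≤ 0 on [τ,δ], ℓ(τ)=1 and ℓ(δ)=0, of Σ_{i=1}^N (∫_τ^δ |ℓ'(s)|^{α_i} |f_i(s)|^{p_i} ds)^{1/p_i}, is at most C (δ−τ)^{−max_i (α_i−1)/p_i − 1/min_i β_i} · Σ_{i=1}^N (∫_τ^δ |f_i(s)|^{β_i} ds)^{1/β_i}. -/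
open Set

open MeasureTheory Filter Topology

lemma evi_markov {μ : Measure ℝ} {h : ℝ → ℝ} (h0 : 0 ≤ h) (hi : Integrable h μ) {c : ℝ} (hc : 0 < c) :
    μ.real {x | c * (∫ x, h x ∂μ) < h x} ≤ 1 / c := by
  rcases (integral_nonneg h0 : 0 ≤ ∫ x, h x ∂μ).eq_or_lt with hJ | hJ
  · have hz := (integral_eq_zero_iff_of_nonneg h0 hi).1 hJ.symm
    have : μ {x | c * (∫ x, h x ∂μ) < h x} = 0 := by
      rw [← hJ, mul_zero]
      rw [measure_eq_zero_iff_ae_notMem]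
      filter_upwards [hz] with x hx
      simp [hx]
    rw [measureReal_def, this]
    simp; exact hc.le
  · have h1 := mul_meas_ge_le_integral_of_nonneg (Eventually.of_forall h0) hi (c * ∫ x, h x ∂μ)
    have h2 : μ.real {x | c * (∫ x, h x ∂μ) < h x} ≤ μ.real {x | c * (∫ x, h x ∂μ) ≤ h x} := by
      refine measureReal_mono (fun x hx => by rw [mem_setOf_eq] at hx ⊢; exact hx.le) ?_
      exact (hi.measure_ge_lt_top (by positivity)).ne
    rw [le_div_iff₀ hc]
    have h3 : (c * μ.real {x | c * (∫ x, h x ∂μ) ≤ h x}) * (∫ x, h x ∂μ) ≤ 1 * ∫ x, h x ∂μ := by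
      linarith
    have h4 := le_of_mul_le_mul_right h3 hJ
    nlinarith

lemma evi_good (N : ℕ) (hN : 0 < N) {τ δ : ℝ} (hτ : τ < δ) (h : Fin N → ℝ → ℝ)
    (hm : ∀ i, Measurable (h i)) (h0 : ∀ i, 0 ≤ h i)
    (hi : ∀ i, IntegrableOn (h i) (Ioc τ δ)) :
    ∃ K : Set ℝ, IsCompact K ∧ K ⊆ Ioc τ δ ∧ (δ - τ) / 4 ≤ volume.real K ∧
      ∀ i, ∀ s ∈ K, h i s ≤ (2 * N / (δ - τ)) * ∫ s in τ..δ, h i s := by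
  have hL : 0 < δ - τ := sub_pos.2 hτ
  have hN' : (0:ℝ) < N := by exact_mod_cast hN
  set μ := (volume : Measure ℝ).restrict (Ioc τ δ) with hμ
  have hc : 0 < 2 * N / (δ - τ) := by positivity
  let B : Fin N → Set ℝ := fun i => {x | (2 * N / (δ - τ)) * (∫ x, h i x ∂μ) < h i x}
  have hBm : ∀ i, MeasurableSet (B i) := fun i => measurableSet_lt measurable_const (hm i)
  have hU : μ.real (⋃ i, B i) ≤ (δ - τ) / 2 := by
    refine (measureReal_iUnion_fintype_le B).trans ?_
    refine (Finset.sum_le_sum fun i _ => evi_markov (h0 i) (hi i) hc).trans ?_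
    simp
    apply le_of_eq
    field_simp
  have hG : (δ - τ) / 2 ≤ volume.real (Ioc τ δ \ ⋃ i, B i) := by
    have e1 : μ.real (⋃ i, B i) = volume.real (Ioc τ δ ∩ ⋃ i, B i) := by
      rw [hμ, measureReal_restrict_apply (MeasurableSet.iUnion hBm), inter_comm]
    have e2 := le_measureReal_sdiff (μ := (volume : Measure ℝ)) (s₁ := Ioc τ δ)
      (s₂ := Ioc τ δ ∩ ⋃ i, B i) ((measure_mono inter_subset_left).trans_lt measure_Ioc_lt_top).ne
    rw [sdiff_self_inter, Real.volume_real_Ioc_of_le hτ.le] at e2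
    linarith
  have hGm : MeasurableSet (Ioc τ δ \ ⋃ i, B i) := measurableSet_Ioc.diff (MeasurableSet.iUnion hBm)
  have hGf : volume (Ioc τ δ \ ⋃ i, B i) ≠ ⊤ :=
    ((measure_mono sdiff_subset).trans_lt measure_Ioc_lt_top).ne
  have : ENNReal.ofReal ((δ - τ) / 4) < volume (Ioc τ δ \ ⋃ i, B i) := by
    rw [ENNReal.ofReal_lt_iff_lt_toReal (by positivity) hGf]
    change _ < volume.real _
    linarith
  obtain ⟨K, hKG, hK, hlt⟩ := hGm.exists_lt_isCompact this
  refine ⟨K, hK, hKG.trans sdiff_subset, ?_, ?_⟩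
  · rw [ENNReal.ofReal_lt_iff_lt_toReal (by positivity) hK.measure_lt_top.ne] at hlt
    exact hlt.le
  · intro i s hs
    have := (hKG hs).2
    simp only [mem_iUnion, not_exists] at this
    have := this i
    rw [intervalIntegral.integral_of_le hτ.le]
    exact not_lt.1 this

lemma evi_test {τ δ : ℝ} (hτ : τ < δ) (g : ℝ → ℝ) (hg : Continuous g) (h0 : ∀ s, 0 ≤ g s)
    (hI : 0 < ∫ s in τ..δ, g s) :
    ∃ ℓ : ℝ → ℝ, ContDiffOn ℝ 1 ℓ (Icc τ δ) ∧
      (∀ s ∈ Icc τ δ, derivWithin ℓ (Icc τ δ) s = - (g s / ∫ s in τ..δ, g s)) ∧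
      ℓ τ = 1 ∧ ℓ δ = 0 := by
  set I := ∫ s in τ..δ, g s with hIdef
  have hd : ∀ s, HasDerivAt (fun s => 1 - (∫ x in τ..s, g x) / I) (- (g s / I)) s := fun s =>
    (((hg.integral_hasStrictDerivAt τ s).hasDerivAt).div_const I).const_sub 1
  refine ⟨fun s => 1 - (∫ x in τ..s, g x) / I, ?_, ?_, by simp, ?_⟩
  · apply ContDiff.contDiffOn
    rw [contDiff_one_iff_deriv]
    refine ⟨fun s => (hd s).differentiableAt, ?_⟩
    have : deriv (fun s => 1 - (∫ x in τ..s, g x) / I) = fun s => - (g s / I) :=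
      funext fun s => (hd s).deriv
    rw [this]
    fun_prop
  · intro s hs
    exact (hd s).hasDerivWithinAt.derivWithin ((uniqueDiffOn_Icc hτ) s hs)
  · simp only
    rw [← hIdef, div_self hI.ne', sub_self]

lemma evi_lim (N : ℕ)
    (α p : Fin N → ℝ)
    (hα : ∀ i, 1 ≤ α i) (hp : ∀ i, 1 ≤ p i) {τ δ : ℝ} (hτ : τ < δ)
    (f : Fin N → ℝ → ℝ) (hf : ∀ i, Measurable (f i))
    (hb : ∀ i, ∃ M : ℝ, ∀ s ∈ Icc τ δ, |f i s| ≤ M)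
    (K : Set ℝ) (hK : IsCompact K) (hKs : K ⊆ Ioc τ δ) (hκ : 0 < volume.real K) :
        sInf { v : ℝ | ∃ ℓ : ℝ → ℝ,
            ContDiffOn ℝ 1 ℓ (Icc τ δ) ∧
            (∀ s ∈ Icc τ δ, derivWithin ℓ (Icc τ δ) s ≤ 0) ∧
            ℓ τ = 1 ∧ ℓ δ = 0 ∧
            v = ∑ i, (∫ s in τ..δ,
                  |derivWithin ℓ (Icc τ δ) s| ^ (α i) * |f i s| ^ (p i)) ^ (1 / p i) }
          ≤ ∑ i, (∫ s in τ..δ,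
                  (K.indicator (fun _ => (1:ℝ)) s / volume.real K) ^ (α i) * |f i s| ^ (p i)) ^ (1 / p i) := by
  set κ := volume.real K with hκd
  let g : ℕ → ℝ → ℝ := fun n s =>
    ((thickenedIndicator (show (0:ℝ) < 1 / ((n:ℝ) + 1) by positivity) K s : NNReal) : ℝ)
  have hgc : ∀ n, Continuous (g n) := fun n =>
    NNReal.continuous_coe.comp (thickenedIndicator _ K).continuous
  have hg0 : ∀ n s, 0 ≤ g n s := fun n s => NNReal.coe_nonneg _
  have hg1 : ∀ n s, g n s ≤ 1 := fun n s => by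
    exact_mod_cast thickenedIndicator_le_one _ K s
  have hgK : ∀ n, ∀ s, K.indicator (fun _ => (1:ℝ)) s ≤ g n s := fun n s => by
    by_cases hs : s ∈ K
    · simp only [hs, indicator_of_mem]
      have := thickenedIndicator_one (show (0:ℝ) < 1 / ((n:ℝ) + 1) by positivity) K hs
      simp only [g, this]; simp
    · simp only [hs, not_false_eq_true, indicator_of_notMem]; exact hg0 n s
  have hgt : ∀ s, Tendsto (fun n => g n s) atTop (𝓝 (K.indicator (fun _ => (1:ℝ)) s)) := fun s => by
    have h1 := thickenedIndicator_tendsto_indicator_closure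
      (δseq := fun n : ℕ => 1 / ((n:ℝ) + 1)) (fun n => by positivity)
      tendsto_one_div_add_atTop_nhds_zero_nat K
    rw [tendsto_pi_nhds] at h1
    have h2 := (NNReal.continuous_coe.tendsto _).comp (h1 s)
    rw [hK.isClosed.closure_eq] at h2
    have h3 : ((K.indicator (fun _ => (1:NNReal)) s : NNReal) : ℝ) = K.indicator (fun _ => (1:ℝ)) s := by
      by_cases hs : s ∈ K <;> simp [hs]
    rw [← h3]
    exact h2
  have hKm := hK.measurableSet
  have hind : ∫ s in τ..δ, K.indicator (fun _ => (1:ℝ)) s = κ := by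
    rw [intervalIntegral.integral_of_le hτ.le, setIntegral_indicator hKm, inter_eq_self_of_subset_right hKs]
    simp [hκd]
  have hindi : IntervalIntegrable (K.indicator (fun _ => (1:ℝ))) volume τ δ := by
    rw [intervalIntegrable_iff, uIoc_of_le hτ.le]
    exact (integrable_const (1:ℝ)).indicator hKm
  have hIκ : ∀ n, κ ≤ ∫ s in τ..δ, g n s := fun n => by
    rw [← hind]
    exact intervalIntegral.integral_mono hτ.le hindi ((hgc n).intervalIntegrable _ _) (hgK n)
  have hIt : Tendsto (fun n => ∫ s in τ..δ, g n s) atTop (𝓝 κ) := by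
    rw [← hind]
    refine intervalIntegral.tendsto_integral_filter_of_dominated_convergence (fun _ => 1)
      (Eventually.of_forall fun n => (hgc n).aestronglyMeasurable) ?_ (by simp) ?_
    · refine Eventually.of_forall fun n => Eventually.of_forall fun s _ => ?_
      rw [Real.norm_eq_abs, abs_of_nonneg (hg0 n s)]; exact hg1 n s
    · exact Eventually.of_forall fun s _ => hgt s
  have hq0 : ∀ n s, 0 ≤ g n s / ∫ s in τ..δ, g n s := fun n s =>
    div_nonneg (hg0 n s) (hκ.le.trans (hIκ n))
  have hq1 : ∀ n s, g n s / (∫ s in τ..δ, g n s) ≤ 1 / κ := fun n s =>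
    div_le_div₀ zero_le_one (hg1 n s) hκ (hIκ n)
  have hlim : Tendsto (fun n => ∑ i, (∫ s in τ..δ,
      (g n s / ∫ s in τ..δ, g n s) ^ (α i) * |f i s| ^ (p i)) ^ (1 / p i)) atTop
      (𝓝 (∑ i, (∫ s in τ..δ,
        (K.indicator (fun _ => (1:ℝ)) s / κ) ^ (α i) * |f i s| ^ (p i)) ^ (1 / p i))) := by
    refine tendsto_finsetSum _ fun i _ => ?_
    refine Tendsto.rpow_const ?_ (Or.inr (by have := hp i; positivity))
    obtain ⟨M, hM⟩ := hb i
    refine intervalIntegral.tendsto_integral_filter_of_dominated_convergence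
      (fun _ => (1 / κ) ^ α i * M ^ p i) (Eventually.of_forall fun n => ?_)
      (Eventually.of_forall fun n => Eventually.of_forall fun s hs => ?_) (by simp)
      (Eventually.of_forall fun s _ => ?_)
    · have := hf i
      have := (hgc n).measurable
      apply Measurable.aestronglyMeasurable
      fun_prop
    · rw [uIoc_of_le hτ.le] at hs
      have hfM := hM s (Ioc_subset_Icc_self hs)
      have := hα i
      have := hp i
      rw [Real.norm_eq_abs, abs_of_nonneg (mul_nonneg (Real.rpow_nonneg (hq0 n s) _) (by positivity))]
      refine mul_le_mul (Real.rpow_le_rpow (hq0 n s) (hq1 n s) (by linarith))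
        (Real.rpow_le_rpow (abs_nonneg _) hfM (by linarith)) (by positivity) (by positivity)
    · have := hα i
      exact (((hgt s).div hIt hκ.ne').rpow_const (Or.inr (by linarith))).mul_const _
  refine ge_of_tendsto' hlim fun n => ?_
  refine csInf_le ⟨0, ?_⟩ ?_
  · rintro v ⟨ℓ, -, -, -, -, rfl⟩
    refine Finset.sum_nonneg fun i _ => Real.rpow_nonneg ?_ _
    exact intervalIntegral.integral_nonneg hτ.le fun s _ => by positivity
  · obtain ⟨ℓ, h1, h2, h3, h4⟩ := evi_test hτ (g n) (hgc n) (hg0 n) (hκ.trans_le (hIκ n))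
    refine ⟨ℓ, h1, fun s hs => ?_, h3, h4, ?_⟩
    · rw [h2 s hs]; linarith [hq0 n s]
    · refine Finset.sum_congr rfl fun i _ => ?_
      congr 1
      refine intervalIntegral.integral_congr fun s hs => ?_
      rw [uIcc_of_le hτ.le] at hs
      rw [h2 s hs, abs_neg, abs_of_nonneg (hq0 n s)]

lemma evi_bound {α p τ δ κ B : ℝ} (hα : 1 ≤ α) (hp : 1 ≤ p) (hτ : τ < δ)
    (f : ℝ → ℝ)
    (K : Set ℝ) (hK : IsCompact K) (hKs : K ⊆ Ioc τ δ) (hκd : κ = volume.real K)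
    (hL : (δ - τ) / 4 ≤ κ) (hB0 : 0 ≤ B)
    (hB : ∀ s ∈ K, |f s| ≤ B) :
    (∫ s in τ..δ, (K.indicator (fun _ => (1:ℝ)) s / κ) ^ α * |f s| ^ p) ^ (1 / p)
      ≤ ((δ - τ) / 4) ^ (-((α - 1) / p)) * B := by
  have hL0 : 0 < (δ - τ) / 4 := by linarith
  have hκ : 0 < κ := by linarith
  have hp0 : 0 < p := by linarith
  have hKm := hK.measurableSet
  have h1 : ∫ s in τ..δ, (K.indicator (fun _ => (1:ℝ)) s / κ) ^ α * |f s| ^ p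
      ≤ ∫ s in τ..δ, K.indicator (fun _ => (1 / κ) ^ α * B ^ p) s := by
    rw [intervalIntegral.integral_of_le hτ.le, intervalIntegral.integral_of_le hτ.le]
    refine integral_mono_of_nonneg (Eventually.of_forall fun s => ?_)
      ((integrable_const _).indicator hKm) (Eventually.of_forall fun s => ?_)
    · refine mul_nonneg (Real.rpow_nonneg (div_nonneg (indicator_nonneg (by simp) _) hκ.le) _) ?_
      positivity
    · by_cases hs : s ∈ K
      · simp only [hs, indicator_of_mem]
        have := Real.rpow_le_rpow (abs_nonneg _) (hB s hs) hp0.le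
        gcongr
      · simp only [hs, not_false_eq_true, indicator_of_notMem, zero_div]
        rw [Real.zero_rpow (by linarith), zero_mul]
  have h2 : ∫ s in τ..δ, K.indicator (fun _ => (1 / κ) ^ α * B ^ p) s = κ ^ (-(α - 1)) * B ^ p := by
    rw [intervalIntegral.integral_of_le hτ.le, setIntegral_indicator hKm,
      inter_eq_self_of_subset_right hKs, setIntegral_const, ← hκd, smul_eq_mul, ← mul_assoc]
    congr 1
    rw [one_div, Real.inv_rpow hκ.le, neg_sub, Real.rpow_sub hκ, Real.rpow_one, div_eq_mul_inv]
  rw [h2] at h1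
  have h0 : 0 ≤ ∫ s in τ..δ, (K.indicator (fun _ => (1:ℝ)) s / κ) ^ α * |f s| ^ p :=
    intervalIntegral.integral_nonneg hτ.le fun s _ =>
      mul_nonneg (Real.rpow_nonneg (div_nonneg (indicator_nonneg (by simp) _) hκ.le) _) (by positivity)
  refine (Real.rpow_le_rpow h0 h1 (by positivity)).trans ?_
  rw [Real.mul_rpow (by positivity) (by positivity), ← Real.rpow_mul hκ.le, ← Real.rpow_mul hB0,
    mul_one_div_cancel hp0.ne', Real.rpow_one]
  refine mul_le_mul_of_nonneg_right ?_ hB0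
  have : -(α - 1) * (1 / p) = -((α - 1) / p) := by ring
  rw [this]
  exact Real.rpow_le_rpow_of_nonpos hL0 hL (by rw [neg_nonpos]; exact div_nonneg (by linarith) hp0.le)

/-- **Lemma 2.3 (elementary variational inequality).** -/
theorem elementary_variational_inequality
    (N : ℕ) (hN : 0 < N)
    (α p β : Fin N → ℝ)
    (hα : ∀ i, 1 ≤ α i) (hp : ∀ i, 1 ≤ p i) (hβ : ∀ i, 0 < β i) :
    ∃ C : ℝ, 0 < C ∧
      ∀ τ δ : ℝ, τ < δ → δ - τ ≤ 1 →
      ∀ f : Fin N → ℝ → ℝ,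
        (∀ i, Measurable (f i)) →
        (∀ i, ∃ M : ℝ, ∀ s ∈ Icc τ δ, |f i s| ≤ M) →
        sInf { v : ℝ | ∃ ℓ : ℝ → ℝ,
            ContDiffOn ℝ 1 ℓ (Icc τ δ) ∧
            (∀ s ∈ Icc τ δ, derivWithin ℓ (Icc τ δ) s ≤ 0) ∧
            ℓ τ = 1 ∧ ℓ δ = 0 ∧
            v = ∑ i, (∫ s in τ..δ,
                  |derivWithin ℓ (Icc τ δ) s| ^ (α i) * |f i s| ^ (p i)) ^ (1 / p i) }
          ≤ C * (δ - τ) ^ (-(⨆ i, (α i - 1) / p i) - (⨅ i, β i)⁻¹)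
              * ∑ i, (∫ s in τ..δ, |f i s| ^ (β i)) ^ (1 / β i) := by
  have hN' : (0:ℝ) < N := by exact_mod_cast hN
  haveI : Nonempty (Fin N) := ⟨⟨0, hN⟩⟩
  let c : Fin N → ℝ := fun i => 4 ^ ((α i - 1) / p i) * (2 * N) ^ (1 / β i)
  have hc : ∀ i, 0 < c i := fun i => by positivity
  have hcC : ∀ i, c i ≤ ∑ j, c j := fun i =>
    Finset.single_le_sum (f := c) (fun j _ => (hc j).le) (Finset.mem_univ i)
  refine ⟨∑ i, c i, Finset.sum_pos (fun i _ => hc i) Finset.univ_nonempty, ?_⟩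
  intro τ δ hτ hδ f hf hb
  have hL : 0 < δ - τ := sub_pos.2 hτ
  have hint : ∀ i, IntegrableOn (fun s => |f i s| ^ β i) (Ioc τ δ) := fun i => by
    obtain ⟨M, hM⟩ := hb i
    refine Measure.integrableOn_of_bounded (M := M ^ β i) measure_Ioc_lt_top.ne ?_ ?_
    · have := hf i
      apply Measurable.aestronglyMeasurable
      fun_prop
    · refine (ae_restrict_iff' measurableSet_Ioc).2 (Eventually.of_forall fun s hs => ?_)
      rw [Real.norm_eq_abs, abs_of_nonneg (by positivity)]
      exact Real.rpow_le_rpow (abs_nonneg _) (hM s (Ioc_subset_Icc_self hs)) (hβ i).le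
  obtain ⟨K, hK, hKs, hκ, hKb⟩ := evi_good N hN hτ (fun i s => |f i s| ^ β i)
    (fun i => by have := hf i; fun_prop) (fun i s => by positivity) hint
  refine (evi_lim N α p hα hp hτ f hf hb K hK hKs (by linarith)).trans ?_
  rw [Finset.mul_sum]
  refine Finset.sum_le_sum fun i _ => ?_
  set J := ∫ s in τ..δ, |f i s| ^ β i with hJ
  have hJ0 : 0 ≤ J := intervalIntegral.integral_nonneg hτ.le fun s _ => by positivity
  refine (evi_bound (hα i) (hp i) hτ (f i) K hK hKs rfl hκ
    (B := (2 * N / (δ - τ) * J) ^ (1 / β i)) (by positivity) ?_).trans ?_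
  · intro s hs
    rw [one_div, Real.le_rpow_inv_iff_of_pos (abs_nonneg _) (by positivity) (hβ i)]
    exact hKb i s hs
  · rw [Real.mul_rpow (by positivity) hJ0, ← mul_assoc]
    refine mul_le_mul_of_nonneg_right ?_ (by positivity)
    have e : ((δ - τ) / 4) ^ (-((α i - 1) / p i)) * (2 * N / (δ - τ)) ^ (1 / β i)
        = c i * (δ - τ) ^ (-((α i - 1) / p i) - 1 / β i) := by
      simp only [c]
      rw [Real.div_rpow hL.le (by norm_num), Real.div_rpow (by positivity) hL.le,
        Real.rpow_sub hL, Real.rpow_neg (by norm_num : (0:ℝ) ≤ 4)]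
      field_simp
    rw [e]
    refine mul_le_mul (hcC i) ?_ (by positivity) (Finset.sum_nonneg fun j _ => (hc j).le)
    refine Real.rpow_le_rpow_of_exponent_ge hL hδ ?_
    have s1 : (α i - 1) / p i ≤ ⨆ i, (α i - 1) / p i :=
      le_ciSup (f := fun i => (α i - 1) / p i) (Set.finite_range _).bddAbove i
    have s2 : ⨅ i, β i ≤ β i := ciInf_le (Set.finite_range _).bddBelow i
    have s3 : 0 < ⨅ i, β i := by
      obtain ⟨j, hj⟩ := exists_eq_ciInf_of_finite (f := β)
      rw [← hj]; exact hβ j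
    have s4 : 1 / β i ≤ (⨅ i, β i)⁻¹ := by
      rw [one_div]; exact inv_anti₀ s3 s2
    linarith
end

section
/- (Lemma 3.3) Let Q = I×D ⊂ ℝ×ℝ^d be a bounded domain (I a bounded interval, D a bounded domain). For any p,q∈[1,∞), there are constants C₁, C₂ > 0, depending only on Q, p, q, such that for every measurable set A ⊆ Q: ‖1_A‖_{𝕃^{q,p}_{t,x}} + ‖1_A‖_{𝕃^{p,q}_{x,t}} ≤ C₁ ‖1_A‖_{𝕃^{1,1}_{t,x}}^{1/(p∨q)} ≤ C₂ ( ‖1_A‖_{𝕃^{q,p}_{t,x}} + ‖1_A‖_{𝕃^{p,q}_{x,t}} )^{1/(p∨q)}, where p∨q := max(p,q). -/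
open MeasureTheory ENNReal Set

noncomputable section

/-- The spatial space `ℝ^d`. -/
abbrev Vec (d : ℕ) := Fin d → ℝ

/-- Mixed norm `‖f‖_{𝕃^{q,p}_{t,x}}` (time outside, space inside). -/
def normTX (d : ℕ) (q p : ℝ≥0∞) (f : ℝ → Vec d → ℝ) : ℝ≥0∞ :=
  eLpNorm (fun t => (eLpNorm (f t) p volume).toReal) q volume

/-- Mixed norm `‖f‖_{𝕃^{p,q}_{x,t}}` (space outside, time inside). -/
def normXT (d : ℕ) (p q : ℝ≥0∞) (f : ℝ → Vec d → ℝ) : ℝ≥0∞ :=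
  eLpNorm (fun x => (eLpNorm (fun t => f t x) q volume).toReal) p volume

/-- The parabolic cylinder `Q_r = [-r²,r²] × B_r`. -/
def pQ (d : ℕ) (r : ℝ) : Set (ℝ × Vec d) := Icc (-r^2) (r^2) ×ˢ Metric.closedBall 0 r

/-- Restriction of a space-time function to a set (multiplication by the indicator). -/
def restr (d : ℕ) (S : Set (ℝ × Vec d)) (f : ℝ → Vec d → ℝ) : ℝ → Vec d → ℝ :=
  fun t x => S.indicator (fun p => f p.1 p.2) (t, x)

/-- Localized norm `|||f|||_{𝕃̃^{q,p}_{t,x}}`. -/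
def tnormTX (d : ℕ) (q p : ℝ≥0∞) (f : ℝ → Vec d → ℝ) : ℝ≥0∞ :=
  ⨆ (s : ℝ) (z : Vec d), normTX d q p (restr d {p : ℝ × Vec d | (p.1 - s, p.2 - z) ∈ pQ d 1} f)

/-- Localized norm `|||f|||_{𝕃̃^{p,q}_{x,t}}`. -/
def tnormXT (d : ℕ) (p q : ℝ≥0∞) (f : ℝ → Vec d → ℝ) : ℝ≥0∞ :=
  ⨆ (s : ℝ) (z : Vec d), normXT d p q (restr d {p : ℝ × Vec d | (p.1 - s, p.2 - z) ∈ pQ d 1} f)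

/-- Localized norm `|||g|||_p` for a function of the space variable only. -/
def tnormX (d : ℕ) (p : ℝ≥0∞) (g : Vec d → ℝ) : ℝ≥0∞ :=
  ⨆ z : Vec d, eLpNorm ((Metric.closedBall z 1).indicator g) p volume

/-- Spatial gradient (componentwise Fréchet derivative; junk value where not differentiable). -/
def sGrad (d : ℕ) (v : Vec d → ℝ) (x : Vec d) : Vec d :=
  fun i => fderiv ℝ v x (Pi.single i 1)

/-- Euclidean length of a vector of `ℝ^d`. -/
def vecLen (d : ℕ) (v : Vec d) : ℝ := Real.sqrt (∑ i, (v i)^2)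

/-- Euclidean length of the spatial gradient `|∇v|(x)`. -/
def gradLen (d : ℕ) (v : Vec d → ℝ) (x : Vec d) : ℝ := vecLen d (sGrad d v x)

/-- `λ(x) := inf_{t ≥ 0, |ξ|=1} ξ·a(t,x)ξ`. -/
def lamFn (d : ℕ) (a : ℝ → Vec d → Matrix (Fin d) (Fin d) ℝ) (x : Vec d) : ℝ :=
  sInf { v | ∃ t ξ, 0 ≤ t ∧ vecLen d ξ = 1 ∧ v = ∑ i, ∑ j, ξ i * a t x i j * ξ j }

/-- `μ(x) := sup_{t ≥ 0, |ξ|=1} |a(t,x)ξ|²/(ξ·a(t,x)ξ)`. -/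
def muFn (d : ℕ) (a : ℝ → Vec d → Matrix (Fin d) (Fin d) ℝ) (x : Vec d) : ℝ :=
  sSup { v | ∃ t ξ, 0 ≤ t ∧ vecLen d ξ = 1 ∧
    v = (∑ i, (∑ j, a t x i j * ξ j)^2) / (∑ i, ∑ j, ξ i * a t x i j * ξ j) }

/-- Assumption (H^a): `|||λ⁻¹|||_{p0} + |||μ|||_{p1} < ∞`. -/
def HypA (d : ℕ) (p0 p1 : ℝ≥0∞) (a : ℝ → Vec d → Matrix (Fin d) (Fin d) ℝ) : Prop :=
  tnormX d p0 (fun x => (lamFn d a x)⁻¹) + tnormX d p1 (muFn d a) < ⊤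

/-- `ϑ₁ := (1-(d-1)/(2p₀))⁻¹`. -/
def theta1 (d : ℕ) (p0 : ℝ≥0∞) : ℝ≥0∞ := (1 - ((d : ℝ≥0∞) - 1) / (2 * p0))⁻¹

/-- `ϑ₂ := (1-d/(2p₀))⁻¹`. -/
def theta2 (d : ℕ) (p0 : ℝ≥0∞) : ℝ≥0∞ := (1 - (d : ℝ≥0∞) / (2 * p0))⁻¹

/-- `ϰ ∈ [1,2]` defined by `2/ϰ = 1/p₀ + 1`. -/
def kappaOf (p0 : ℝ≥0∞) : ℝ≥0∞ := 2 / (1 / p0 + 1)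

/-- The index set `𝕀^d_{p₀}`: `(p,q)` with `1/p < (1 - 1/q)(2/d - 1/p₀)`. -/
def memI (d : ℕ) (p0 p q : ℝ≥0∞) : Prop :=
  1 ≤ p ∧ 1 ≤ q ∧ 1 / p < (1 - 1 / q) * (2 / (d : ℝ≥0∞) - 1 / p0)

/-- The index set `ℐ_ϰ` (with `ϰ` an extended real exponent):
`(r,s) ∈ [2,∞) × [1,∞)` with `1/2 - 1/r < (1/s)(2/d + 1 - 2/ϰ)`. -/
def memScrI (d : ℕ) (k r s : ℝ≥0∞) : Prop :=
  2 ≤ r ∧ r < ⊤ ∧ 1 ≤ s ∧ s < ⊤ ∧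
    1 / 2 - 1 / r < (1 / s) * (2 / (d : ℝ≥0∞) + 1 - 2 / k)

/-- The local energy norm `‖f‖_{𝒱_Q}` (with parameter `ϰ = k`). -/
def VQ (d : ℕ) (k : ℝ≥0∞) (Q : Set (ℝ × Vec d)) (u : ℝ → Vec d → ℝ) : ℝ≥0∞ :=
  normTX d ⊤ 2 (restr d Q u) + normXT d k 2 (restr d Q (fun t x => gradLen d (u t) x))

/-- The global norm `|||f|||_{𝒱̃}` (with parameter `ϰ = k`). -/
def tnormV (d : ℕ) (k : ℝ≥0∞) (u : ℝ → Vec d → ℝ) : ℝ≥0∞ :=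
  tnormTX d ⊤ 2 u + tnormXT d k 2 (fun t x => gradLen d (u t) x)

/-- A continuous function `u` with locally bounded spatial gradient is a Lipschitz weak
solution of `∂ₜ u = div(a·∇u) + b·∇u + f` if the weak formulation holds for all nonnegative
compactly supported Lipschitz test functions. -/
def IsLipschitzWeakSolution (d : ℕ) (a : ℝ → Vec d → Matrix (Fin d) (Fin d) ℝ)
    (b : ℝ → Vec d → Vec d) (f : ℝ → Vec d → ℝ) (u : ℝ → Vec d → ℝ) : Prop :=
  Continuous (fun p : ℝ × Vec d => u p.1 p.2) ∧
  (∀ K : Set (ℝ × Vec d), IsCompact K → ∃ M, ∀ p ∈ K, gradLen d (u p.1) p.2 ≤ M) ∧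
  ∀ φ : ℝ × Vec d → ℝ, (∃ L, LipschitzWith L φ) → HasCompactSupport φ → (∀ p, 0 ≤ φ p) →
    -(∫ p : ℝ × Vec d, u p.1 p.2 * deriv (fun s => φ (s, p.2)) p.1)
      = -(∫ p : ℝ × Vec d,
            ∑ i, (∑ j, a p.1 p.2 i j * sGrad d (u p.1) p.2 j) * sGrad d (fun x => φ (p.1, x)) p.2 i)
        + (∫ p : ℝ × Vec d, (∑ i, b p.1 p.2 i * sGrad d (u p.1) p.2 i) * φ p)
        + (∫ p : ℝ × Vec d, f p.1 p.2 * φ p)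

/-- Lipschitz weak subsolution: same as above with `≤` instead of `=`. -/
def IsLipschitzWeakSubsolution (d : ℕ) (a : ℝ → Vec d → Matrix (Fin d) (Fin d) ℝ)
    (b : ℝ → Vec d → Vec d) (f : ℝ → Vec d → ℝ) (u : ℝ → Vec d → ℝ) : Prop :=
  Continuous (fun p : ℝ × Vec d => u p.1 p.2) ∧
  (∀ K : Set (ℝ × Vec d), IsCompact K → ∃ M, ∀ p ∈ K, gradLen d (u p.1) p.2 ≤ M) ∧
  ∀ φ : ℝ × Vec d → ℝ, (∃ L, LipschitzWith L φ) → HasCompactSupport φ → (∀ p, 0 ≤ φ p) →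
    -(∫ p : ℝ × Vec d, u p.1 p.2 * deriv (fun s => φ (s, p.2)) p.1)
      ≤ -(∫ p : ℝ × Vec d,
            ∑ i, (∑ j, a p.1 p.2 i j * sGrad d (u p.1) p.2 j) * sGrad d (fun x => φ (p.1, x)) p.2 i)
        + (∫ p : ℝ × Vec d, (∑ i, b p.1 p.2 i * sGrad d (u p.1) p.2 i) * φ p)
        + (∫ p : ℝ × Vec d, f p.1 p.2 * φ p)

/-- Assumption (H^b), split into its pieces, for `b = b₁ + b₂`. -/
def HypB (d : ℕ) (p0 p2 q2 p3 q3 : ℝ≥0∞) (b b1 b2 : ℝ → Vec d → Vec d) : Prop :=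
  (∀ t x, b t x = b1 t x + b2 t x) ∧
  (p0 ≤ (d : ℝ≥0∞) → ∀ t x, b1 t x = 0) ∧
  ((d : ℝ≥0∞) < p0 →
    1 ≤ p2 ∧ 1 ≤ q2 ∧
    1 / (2 * p0) + 1 / p2 < (1 / 2 - 1 / q2) * (2 / (d : ℝ≥0∞) - 1 / p0) ∧
    tnormTX d q2 p2 (fun t x => vecLen d (b1 t x)) < ⊤) ∧
  (1 ≤ p3 ∧ p3 ≤ q3 ∧
    ((d : ℝ≥0∞) - 1) * theta1 d p0 / p3
      + (2 + theta1 d p0 + (d : ℝ≥0∞) * (theta2 d p0 - theta1 d p0)) / q3 < 2) ∧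
  -- `(div b₂)⁻ = 0`: distributionally `div b₂ ≥ 0`.
  (∀ φ : ℝ × Vec d → ℝ, ContDiff ℝ (⊤ : ℕ∞) φ → HasCompactSupport φ → (∀ p, 0 ≤ φ p) →
    (∫ p : ℝ × Vec d, ∑ i, b2 p.1 p.2 i * sGrad d (fun x => φ (p.1, x)) p.2 i) ≤ 0) ∧
  tnormXT d p3 q3 (fun t x => vecLen d (b2 t x)) < ⊤

theorem aux_compare {α : Type*} [MeasurableSpace α] (μ : Measure α) (S : Set α)
    (b : ℝ≥0∞) (r r' s s' : ℝ) (hr : 1 ≤ r) (hrr : r ≤ r') (hs : 1 ≤ s) (hss : s ≤ s')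
    (a : α → ℝ≥0∞) (ha : Measurable a) (hab : ∀ t, a t ≤ b) (haS : ∀ t, t ∉ S → a t = 0) :
    eLpNorm (fun t => a t ^ (1 / s)) (ENNReal.ofReal r) μ ≤
      b ^ (1 / s - 1 / s') * μ S ^ (1 / r - 1 / r')
        * eLpNorm (fun t => a t ^ (1 / s')) (ENNReal.ofReal r') μ := by
  have hs0 : 0 < 1 / s := by positivity
  have hs0' : 0 < 1 / s' := by have : 0 < s' := by linarith
                               positivity
  have hd : 0 ≤ 1 / s - 1 / s' := by
    have := one_div_le_one_div_of_le (by linarith) hss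
    linarith
  have supp : ∀ c : ℝ, 0 < c → Function.support (fun t => a t ^ c) ⊆ S := by
    intro c hc t ht
    by_contra h
    apply ht
    simp [haS t h, hc]
  have h1 : eLpNorm (fun t => a t ^ (1 / s)) (ENNReal.ofReal r) μ ≤
      eLpNorm (fun t => a t ^ (1 / s)) (ENNReal.ofReal r') μ * μ S ^ (1 / r - 1 / r') := by
    rw [← eLpNorm_restrict_eq_of_support_subset (supp _ hs0),
      ← eLpNorm_restrict_eq_of_support_subset (p := ENNReal.ofReal r') (supp _ hs0)]
    have := eLpNorm_le_eLpNorm_mul_rpow_measure_univ (μ := μ.restrict S)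
      (f := fun t => a t ^ (1 / s)) (ENNReal.ofReal_le_ofReal hrr)
      (ha.pow_const _).aestronglyMeasurable
    rwa [ENNReal.toReal_ofReal (by linarith), ENNReal.toReal_ofReal (by linarith),
      Measure.restrict_apply_univ] at this
  have h2 : eLpNorm (fun t => a t ^ (1 / s)) (ENNReal.ofReal r') μ ≤
      b ^ (1 / s - 1 / s') * eLpNorm (fun t => a t ^ (1 / s')) (ENNReal.ofReal r') μ := by
    have hr0 : ENNReal.ofReal r' ≠ 0 := by
      simp only [ne_eq, ENNReal.ofReal_eq_zero, not_le]; linarith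
    have hr1 : 0 < r' := by linarith
    have key : ∀ t, a t ^ (1 / s) ≤ b ^ (1 / s - 1 / s') * a t ^ (1 / s') := by
      intro t
      calc a t ^ (1 / s) = a t ^ ((1 / s - 1 / s') + 1 / s') := by congr 1; ring
        _ = a t ^ (1 / s - 1 / s') * a t ^ (1 / s') :=
          ENNReal.rpow_add_of_nonneg _ _ hd hs0'.le
        _ ≤ _ := by gcongr; exact hab t
    rw [eLpNorm_eq_lintegral_rpow_enorm_toReal hr0 ENNReal.ofReal_ne_top,
      eLpNorm_eq_lintegral_rpow_enorm_toReal hr0 ENNReal.ofReal_ne_top,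
      ENNReal.toReal_ofReal hr1.le]
    simp only [enorm_eq_self]
    calc (∫⁻ t, (a t ^ (1 / s)) ^ r' ∂μ) ^ (1 / r')
        ≤ (∫⁻ t, (b ^ (1 / s - 1 / s')) ^ r' * (a t ^ (1 / s')) ^ r' ∂μ) ^ (1 / r') := by
          gcongr with t
          rw [← ENNReal.mul_rpow_of_nonneg _ _ hr1.le]
          gcongr
          exact key t
      _ = _ := by
          rw [lintegral_const_mul _ ((ha.pow_const _).pow_const _),
            ENNReal.mul_rpow_of_nonneg _ _ (by positivity), ← ENNReal.rpow_mul,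
            mul_one_div_cancel hr1.ne', ENNReal.rpow_one]
  calc _ ≤ _ := h1
    _ ≤ _ := mul_le_mul_left h2 _
    _ = _ := by ring

theorem aux_diag {α : Type*} [MeasurableSpace α] (μ : Measure α) (r : ℝ) (hr : 1 ≤ r)
    (a : α → ℝ≥0∞) :
    eLpNorm (fun t => a t ^ (1 / r)) (ENNReal.ofReal r) μ = (∫⁻ t, a t ∂μ) ^ (1 / r) := by
  have hr1 : 0 < r := by linarith
  rw [eLpNorm_eq_lintegral_rpow_enorm_toReal (by simpa using hr1) ENNReal.ofReal_ne_top,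
      ENNReal.toReal_ofReal hr1.le]
  simp only [enorm_eq_self, ← ENNReal.rpow_mul, one_div_mul_cancel hr1.ne', ENNReal.rpow_one]

theorem aux_norm {α β : Type*} [MeasurableSpace α] [MeasurableSpace β] (μ : Measure α)
    (ν : Measure β) (P : ℝ≥0∞) (s : ℝ) (hs : 1 ≤ s) (B : α → Set β) (hB : ∀ t, MeasurableSet (B t))
    (hfin : ∀ t, ν (B t) ≠ ∞) :
    eLpNorm (fun t => (eLpNorm ((B t).indicator (fun _ => (1:ℝ))) (ENNReal.ofReal s) ν).toReal)
      P μ = eLpNorm (fun t => ν (B t) ^ (1 / s)) P μ := by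
  have hs1 : 0 < s := by linarith
  apply eLpNorm_congr_enorm_ae
  refine Filter.Eventually.of_forall fun t => ?_
  have h : eLpNorm ((B t).indicator (fun _ => (1:ℝ))) (ENNReal.ofReal s) ν = ν (B t) ^ (1 / s) := by
    rw [eLpNorm_indicator_const (hB t) (by simpa using hs1) ENNReal.ofReal_ne_top,
      ENNReal.toReal_ofReal hs1.le]
    simp
  simp only [h, enorm_eq_self]
  exact Real.enorm_toReal (ENNReal.rpow_ne_top_of_nonneg (by positivity) (hfin t))

/-- **Lemma 3.3.** -/
theorem indicator_mixed_norm_comparison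
    (d : ℕ) (t₀ t₁ : ℝ) (ht : t₀ < t₁)
    (D : Set (Vec d)) (hD : IsOpen D) (hDb : Bornology.IsBounded D) (hDne : D.Nonempty)
    (p q : ℝ) (hp : 1 ≤ p) (hq : 1 ≤ q) :
    ∃ C₁ C₂ : ℝ, 0 < C₁ ∧ 0 < C₂ ∧
      ∀ A : Set (ℝ × Vec d), MeasurableSet A → A ⊆ Icc t₀ t₁ ×ˢ D →
        (normTX d (ENNReal.ofReal q) (ENNReal.ofReal p)
              (fun t x => A.indicator (fun _ => (1:ℝ)) (t, x))
            + normXT d (ENNReal.ofReal p) (ENNReal.ofReal q)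
              (fun t x => A.indicator (fun _ => (1:ℝ)) (t, x))
          ≤ ENNReal.ofReal C₁
            * (normTX d 1 1 (fun t x => A.indicator (fun _ => (1:ℝ)) (t, x)))
                ^ (1 / max p q)) ∧
        (ENNReal.ofReal C₁
            * (normTX d 1 1 (fun t x => A.indicator (fun _ => (1:ℝ)) (t, x))) ^ (1 / max p q)
          ≤ ENNReal.ofReal C₂
            * (normTX d (ENNReal.ofReal q) (ENNReal.ofReal p)
                  (fun t x => A.indicator (fun _ => (1:ℝ)) (t, x))
                + normXT d (ENNReal.ofReal p) (ENNReal.ofReal q)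
                  (fun t x => A.indicator (fun _ => (1:ℝ)) (t, x))) ^ (1 / max p q)) := by
  set M := max p q with hM
  have hM1 : 1 ≤ M := le_max_of_le_left hp
  have hpM : p ≤ M := le_max_left _ _
  have hqM : q ≤ M := le_max_right _ _
  have hM0 : 0 < M := by linarith
  have dnn : ∀ x y : ℝ, 1 ≤ x → x ≤ y → 0 ≤ 1 / x - 1 / y := by
    intro x y hx hxy
    have := one_div_le_one_div_of_le (by linarith) hxy
    linarith
  have hbD : volume D ≠ ∞ := hDb.measure_lt_top.ne
  have hbI : volume (Icc t₀ t₁) ≠ ∞ := by simp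
  set bD := volume D
  set bI := volume (Icc t₀ t₁)
  have fin : ∀ x y x' y' : ℝ, 1 ≤ x → x ≤ y → 1 ≤ x' → x' ≤ y' →
      bD ^ (1 / x - 1 / y) * bI ^ (1 / x' - 1 / y') ≠ ∞ := fun x y x' y' h1 h2 h3 h4 =>
    ENNReal.mul_ne_top (ENNReal.rpow_ne_top_of_nonneg (dnn _ _ h1 h2) hbD)
      (ENNReal.rpow_ne_top_of_nonneg (dnn _ _ h3 h4) hbI)
  set K1 := bD ^ (1 / p - 1 / M) * bI ^ (1 / q - 1 / M) with hK1
  set K2 := bD ^ (1 / 1 - 1 / p) * bI ^ (1 / 1 - 1 / q) with hK2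
  have hK1f : K1 ≠ ∞ := fin _ _ _ _ hp hpM hq hqM
  have hK2f : K2 ≠ ∞ := fin _ _ _ _ le_rfl hp le_rfl hq
  set c1 : ℝ := (K1 + K1).toReal + 1 with hc1
  set c2 : ℝ := K2.toReal + 1 with hc2
  have hc1p : 0 < c1 := by positivity
  have hc2p : 0 < c2 := by positivity
  have hc1le : K1 + K1 ≤ ENNReal.ofReal c1 := by
    rw [← ENNReal.ofReal_toReal (ENNReal.add_ne_top.2 ⟨hK1f, hK1f⟩)]
    exact ENNReal.ofReal_le_ofReal (by linarith)
  have hc2le : K2 ≤ ENNReal.ofReal c2 := by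
    rw [← ENNReal.ofReal_toReal hK2f]
    exact ENNReal.ofReal_le_ofReal (by linarith)
  refine ⟨c1, c1 * c2 ^ (1 / M), hc1p, by positivity, fun A hA hAQ => ?_⟩
  have hBt : ∀ t : ℝ, MeasurableSet (Prod.mk t ⁻¹' A) := fun t => measurable_prodMk_left hA
  have hBx : ∀ x : Vec d, MeasurableSet ((fun t : ℝ => (t, x)) ⁻¹' A) :=
    fun x => measurable_prodMk_right hA
  have hat : ∀ t : ℝ, volume (Prod.mk t ⁻¹' A) ≤ bD := fun t =>
    measure_mono fun x hx => (hAQ hx).2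
  have hax : ∀ x : Vec d, volume ((fun t : ℝ => (t, x)) ⁻¹' A) ≤ bI := fun x =>
    measure_mono fun t ht => (hAQ ht).1
  have hat0 : ∀ t : ℝ, t ∉ Icc t₀ t₁ → volume (Prod.mk t ⁻¹' A) = 0 := by
    intro t h
    have : Prod.mk t ⁻¹' A = ∅ := eq_empty_of_forall_notMem fun x hx => h (hAQ hx).1
    rw [this, measure_empty]
  have hax0 : ∀ x : Vec d, x ∉ D → volume ((fun t : ℝ => (t, x)) ⁻¹' A) = 0 := by
    intro t h
    have : (fun s : ℝ => (s, t)) ⁻¹' A = ∅ := eq_empty_of_forall_notMem fun x hx => h (hAQ hx).2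
    rw [this, measure_empty]
  have hmt : Measurable fun t : ℝ => volume (Prod.mk t ⁻¹' A) := measurable_measure_prodMk_left hA
  have hmx : Measurable fun x : Vec d => volume ((fun t : ℝ => (t, x)) ⁻¹' A) :=
    measurable_measure_prodMk_right hA
  have hTX : ∀ Q s : ℝ, 1 ≤ s → normTX d (ENNReal.ofReal Q) (ENNReal.ofReal s)
      (fun t x => A.indicator (fun _ => (1:ℝ)) (t, x)) =
      eLpNorm (fun t : ℝ => volume (Prod.mk t ⁻¹' A) ^ (1 / s)) (ENNReal.ofReal Q) volume := by
    intro Q s hs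
    exact aux_norm volume volume _ s hs (fun t : ℝ => Prod.mk t ⁻¹' A) hBt
      (fun t => ne_top_of_le_ne_top hbD (hat t))
  have hXT : ∀ P s : ℝ, 1 ≤ s → normXT d (ENNReal.ofReal P) (ENNReal.ofReal s)
      (fun t x => A.indicator (fun _ => (1:ℝ)) (t, x)) =
      eLpNorm (fun x : Vec d => volume ((fun t : ℝ => (t, x)) ⁻¹' A) ^ (1 / s))
        (ENNReal.ofReal P) volume := by
    intro P s hs
    exact aux_norm volume volume _ s hs (fun x : Vec d => (fun t : ℝ => (t, x)) ⁻¹' A) hBx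
      (fun t => ne_top_of_le_ne_top hbI (hax t))
  have h11 : normTX d 1 1 (fun t x => A.indicator (fun _ => (1:ℝ)) (t, x)) =
      ∫⁻ t : ℝ, volume (Prod.mk t ⁻¹' A) := by
    have h := hTX 1 1 le_rfl
    rw [aux_diag volume 1 le_rfl] at h
    simpa using h
  have hfub : ∫⁻ x : Vec d, volume ((fun t : ℝ => (t, x)) ⁻¹' A) =
      ∫⁻ t : ℝ, volume (Prod.mk t ⁻¹' A) := by
    rw [← Measure.prod_apply hA, ← Measure.prod_apply_symm hA]
  have u1 := aux_compare volume (Icc t₀ t₁) bD q M p M hq hqM hp hpM _ hmt hat hat0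
  have u2 := aux_compare volume D bI p M q M hp hpM hq hqM _ hmx hax hax0
  have u3 := aux_compare volume (Icc t₀ t₁) bD 1 q 1 p le_rfl hq le_rfl hp _ hmt hat hat0
  rw [aux_diag volume M hM1, ← h11] at u1
  rw [aux_diag volume M hM1, hfub, ← h11, mul_comm (bI ^ _)] at u2
  rw [aux_diag volume 1 le_rfl, ← h11, ← hTX q p hp, one_div_one, ENNReal.rpow_one] at u3
  rw [← hTX q p hp] at u1
  rw [← hXT p q hq] at u2
  constructor
  · refine (add_le_add u1 u2).trans ?_
    rw [← add_mul]
    gcongr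
  · rw [ENNReal.ofReal_mul hc1p.le, mul_assoc, ← ENNReal.ofReal_rpow_of_pos hc2p,
      ← ENNReal.mul_rpow_of_nonneg _ _ (by positivity)]
    gcongr
    refine u3.trans ?_
    rw [one_div_one] at hK2
    rw [← hK2]
    gcongr
    exact le_self_add
end
end
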